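/- Let G = (B,ψ,A) be a quantum graph with δ-form ψ and quantum edge indicator ε_G := (1/δ²)(1⊗A)m*(1). Define the multiplication # on B⊗B by (a⊗b)#(c⊗d) := (ac)⊗(db). Then ε_G # ε_G = ε_G. -/

import Mathlib

open scoped TensorProduct
open TensorProduct

noncomputable section


open scoped TensorProduct
open TensorProduct

noncomputable section

variable {B : Type*} [Ring B] [StarRing B] [Algebra ℂ B] [StarModule ℂ B]
  [Module.Finite ℂ B] [Module.Free ℂ B]

/-- The multiplication map `m : B ⊗ B → B`. -/
abbrev mulMap (B : Type*) [Ring B] [Algebra ℂ B] : B ⊗[ℂ] B →ₗ[ℂ] B := LinearMap.mul' ℂ B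

/-- `ψ ⊗ ψ` as a functional on `B ⊗ B`. -/
def psi2 (ψ : B →ₗ[ℂ] ℂ) : B ⊗[ℂ] B →ₗ[ℂ] ℂ :=
  (TensorProduct.lid ℂ ℂ).toLinearMap ∘ₗ TensorProduct.map ψ ψ

/-- `ψ ⊗ id : B ⊗ B → B`. -/
def psiOne (ψ : B →ₗ[ℂ] ℂ) : B ⊗[ℂ] B →ₗ[ℂ] B :=
  (TensorProduct.lid ℂ B).toLinearMap ∘ₗ TensorProduct.map ψ LinearMap.id

/-- `ψ` is a faithful state. -/
def IsState (ψ : B →ₗ[ℂ] ℂ) : Prop :=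
  ψ 1 = 1 ∧ (∀ x : B, 0 ≤ (ψ (star x * x)).re ∧ (ψ (star x * x)).im = 0) ∧
    ∀ x : B, ψ (star x * x) = 0 → x = 0

/-- `mstar` is the adjoint of multiplication w.r.t. the GNS inner products of `ψ`:
`⟪y ⊗ z, m*(x)⟫_{ψ⊗ψ} = ⟪y * z, x⟫_ψ`. -/
def IsAdjointMul (ψ : B →ₗ[ℂ] ℂ) (mstar : B →ₗ[ℂ] B ⊗[ℂ] B) : Prop :=
  ∀ x y z : B, psi2 ψ ((star y ⊗ₜ[ℂ] star z) * mstar x) = ψ (star (y * z) * x)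

/-- `ψ` is a `δ`-form: `m m* = δ² id`. -/
def IsDeltaForm (mstar : B →ₗ[ℂ] B ⊗[ℂ] B) (δ : ℝ) : Prop :=
  ∀ x : B, mulMap B (mstar x) = ((δ : ℂ)^2) • x

/-- `A` is a quantum adjacency matrix: `m (A ⊗ A) m* = δ² A`. -/
def IsQAdj (mstar : B →ₗ[ℂ] B ⊗[ℂ] B) (δ : ℝ) (A : B →ₗ[ℂ] B) : Prop :=
  ∀ x : B, mulMap B (TensorProduct.map A A (mstar x)) = ((δ : ℂ)^2) • A x

/-- The quantum edge indicator `ε = (1/δ²)(1 ⊗ A) m*(1)`. -/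
def edgeInd (mstar : B →ₗ[ℂ] B ⊗[ℂ] B) (δ : ℝ) (A : B →ₗ[ℂ] B) : B ⊗[ℂ] B :=
  (((δ : ℂ)^2)⁻¹) • (LinearMap.lTensor B A) (mstar 1)

/-- The `#`-multiplication on `B ⊗ B`: `(a⊗b)#(c⊗d) = (ac)⊗(db)` (i.e. `B ⊗ Bᵒᵖ`). -/
def hashMul (ξ η : B ⊗[ℂ] B) : B ⊗[ℂ] B :=
  (TensorProduct.congr (LinearEquiv.refl ℂ B) (MulOpposite.opLinearEquiv ℂ (M := B))).symm
    ((TensorProduct.congr (LinearEquiv.refl ℂ B) (MulOpposite.opLinearEquiv ℂ (M := B))) ξ *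
      (TensorProduct.congr (LinearEquiv.refl ℂ B) (MulOpposite.opLinearEquiv ℂ (M := B))) η)

/-- The (conjugate-linear) star operation on `B ⊗ B`, `star (a ⊗ b) = star a ⊗ star b`,
defined via a choice of basis. -/
def starT (ξ : B ⊗[ℂ] B) : B ⊗[ℂ] B :=
  ∑ p : Module.Free.ChooseBasisIndex ℂ B × Module.Free.ChooseBasisIndex ℂ B,
    (starRingEnd ℂ)
      (((Module.Free.chooseBasis ℂ B).tensorProduct (Module.Free.chooseBasis ℂ B)).repr ξ p) •
      (star ((Module.Free.chooseBasis ℂ B) p.1) ⊗ₜ[ℂ] star ((Module.Free.chooseBasis ℂ B) p.2))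

/-- The `B`-valued inner product on `B ⊗ B`: `⟨a⊗b, c⊗d⟩_B = ψ(a*c) b* d`. -/
def bip (ψ : B →ₗ[ℂ] ℂ) (ξ η : B ⊗[ℂ] B) : B := psiOne ψ (starT ξ * η)

/-- Positivity in a star ring. -/
def IsPosEl {R : Type*} [Ring R] [StarRing R] (x : R) : Prop := ∃ y, x = star y * y

/-- Complete positivity of a linear map on `B`. -/
def IsCP (A : B →ₗ[ℂ] B) : Prop :=
  ∀ (n : ℕ) (M : Matrix (Fin n) (Fin n) B), IsPosEl M → IsPosEl (M.map A)

/-- The map `A_ξ : x ↦ δ² (ψ ⊗ 1)(x · ξ)`. -/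
def Axi (ψ : B →ₗ[ℂ] ℂ) (δ : ℝ) (ξ : B ⊗[ℂ] B) : B →ₗ[ℂ] B :=
  ((δ : ℂ)^2) • ((psiOne ψ) ∘ₗ ((LinearMap.mul ℂ (B ⊗[ℂ] B)).flip ξ) ∘ₗ
    (Algebra.TensorProduct.includeLeft : B →ₐ[ℂ] B ⊗[ℂ] B).toLinearMap)

/-- The quantum edge correspondence `E_G = B · ε_G · B` as a subspace of `B ⊗ B`. -/
def EGspan (mstar : B →ₗ[ℂ] B ⊗[ℂ] B) (δ : ℝ) (A : B →ₗ[ℂ] B) : Submodule ℂ (B ⊗[ℂ] B) :=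
  Submodule.span ℂ
    {z : B ⊗[ℂ] B | ∃ x y : B, z = (x ⊗ₜ[ℂ] (1 : B)) * edgeInd mstar δ A * ((1 : B) ⊗ₜ[ℂ] y)}


/-- A faithful state represents every functional as `x ↦ ψ (y * x)`. -/
lemma IsState.exists_mul_eq {C : Type*} [Ring C] [StarRing C] [Algebra ℂ C] [Module.Finite ℂ C]
    {ψ : C →ₗ[ℂ] ℂ} (hψ : IsState ψ) (f : C →ₗ[ℂ] ℂ) :
    ∃ y : C, ∀ x, ψ (y * x) = f x := by
  let Φ : C →ₗ[ℂ] Module.Dual ℂ C := (LinearMap.mul ℂ C).compr₂ ψ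
  have hinj : Function.Injective Φ := by
    refine (injective_iff_map_eq_zero Φ).2 fun y hy => ?_
    have h := hψ.2.2 (star y) (by simpa [Φ] using LinearMap.congr_fun hy (star y))
    simpa using h
  obtain ⟨y, hy⟩ :=
    (LinearMap.injective_iff_surjective_of_finrank_eq_finrank
      (Subspace.dual_finrank_eq (K := ℂ) (V := C)).symm).1 hinj f
  exact ⟨y, fun x => LinearMap.congr_fun hy x⟩

lemma psi2_tmul {C : Type*} [Ring C] [Algebra ℂ C]
    (ψ : C →ₗ[ℂ] ℂ) (a b : C) : psi2 ψ (a ⊗ₜ[ℂ] b) = ψ a * ψ b := by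
  simp [psi2]

/-- The pairing `psi2` is nondegenerate for a faithful state. -/
lemma IsState.tensor_ext {ψ : B →ₗ[ℂ] ℂ} (hψ : IsState ψ) {ξ η : B ⊗[ℂ] B}
    (h : ∀ y z : B, psi2 ψ ((y ⊗ₜ[ℂ] z) * ξ) = psi2 ψ ((y ⊗ₜ[ℂ] z) * η)) : ξ = η := by
  let b := Module.Free.chooseBasis ℂ B
  refine (b.tensorProduct b).repr.injective (Finsupp.ext fun p => ?_)
  obtain ⟨y, hy⟩ := hψ.exists_mul_eq (b.coord p.1)
  obtain ⟨z, hz⟩ := hψ.exists_mul_eq (b.coord p.2)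
  have key : (psi2 ψ) ∘ₗ LinearMap.mulLeft ℂ (y ⊗ₜ[ℂ] z) = (b.tensorProduct b).coord p := by
    refine TensorProduct.ext' fun u v => ?_
    obtain ⟨i, j⟩ := p
    simp only [Module.Basis.coord_apply] at hy hz
    simp [psi2_tmul, hy, hz, mul_comm]
  have hξ := LinearMap.congr_fun key ξ
  have hη := LinearMap.congr_fun key η
  simp only [LinearMap.comp_apply, LinearMap.mulLeft_apply, Module.Basis.coord_apply] at hξ hη
  rw [← hξ, ← hη, h]

lemma IsAdjointMul.psi2_mul {C : Type*} [Ring C] [StarRing C] [Algebra ℂ C]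
    {ψ : C →ₗ[ℂ] ℂ} {mstar : C →ₗ[ℂ] C ⊗[ℂ] C}
    (hadj : IsAdjointMul ψ mstar) (x y z : C) :
    psi2 ψ ((y ⊗ₜ[ℂ] z) * mstar x) = ψ (z * y * x) := by
  simpa using hadj x (star y) (star z)

/-- The adjoint of multiplication is a left module map. -/
lemma IsAdjointMul.left_mul {ψ : B →ₗ[ℂ] ℂ} (hψ : IsState ψ) {mstar : B →ₗ[ℂ] B ⊗[ℂ] B}
    (hadj : IsAdjointMul ψ mstar) (a x : B) :
    mstar (a * x) = (a ⊗ₜ[ℂ] 1) * mstar x := by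
  refine hψ.tensor_ext fun y z => ?_
  rw [← mul_assoc, Algebra.TensorProduct.tmul_mul_tmul, mul_one, hadj.psi2_mul, hadj.psi2_mul]
  simp only [mul_assoc]

/-- The adjoint of multiplication is a right module map. -/
lemma IsAdjointMul.right_mul {ψ : B →ₗ[ℂ] ℂ} (hψ : IsState ψ) {mstar : B →ₗ[ℂ] B ⊗[ℂ] B}
    (hadj : IsAdjointMul ψ mstar) (x w : B) :
    mstar (x * w) = mstar x * (1 ⊗ₜ[ℂ] w) := by
  obtain ⟨s, hs⟩ := hψ.exists_mul_eq (ψ ∘ₗ LinearMap.mulRight ℂ w)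
  simp only [LinearMap.comp_apply, LinearMap.mulRight_apply] at hs
  refine hψ.tensor_ext fun y z => ?_
  have key : psi2 ψ ∘ₗ LinearMap.mulLeft ℂ (y ⊗ₜ[ℂ] z) ∘ₗ
      LinearMap.mulRight ℂ ((1 : B) ⊗ₜ[ℂ] w) =
      psi2 ψ ∘ₗ LinearMap.mulLeft ℂ (y ⊗ₜ[ℂ] (s * z)) := by
    refine TensorProduct.ext' fun u v => ?_
    simp [psi2_tmul, mul_assoc, hs]
  have h := LinearMap.congr_fun key (mstar x)
  simp only [LinearMap.comp_apply, LinearMap.mulLeft_apply, LinearMap.mulRight_apply] at h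
  rw [h, hadj.psi2_mul, hadj.psi2_mul, ← mul_assoc, ← hs]
  simp only [mul_assoc]

lemma hashMul_tmul {C : Type*} [Ring C] [Algebra ℂ C]
    (a b c d : C) :
    hashMul (a ⊗ₜ[ℂ] b) (c ⊗ₜ[ℂ] d) = (a * c) ⊗ₜ[ℂ] (d * b) := by
  simp [hashMul, ← MulOpposite.op_mul]

lemma hashMul_sum_sum {C : Type*} [Ring C] [Algebra ℂ C]
    {ι κ : Type*} (s : Finset ι) (t : Finset κ)
    (f : ι → C ⊗[ℂ] C) (g : κ → C ⊗[ℂ] C) :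
    hashMul (∑ i ∈ s, f i) (∑ j ∈ t, g j) = ∑ i ∈ s, ∑ j ∈ t, hashMul (f i) (g j) := by
  simp only [hashMul, map_sum, Finset.sum_mul_sum]

lemma hashMul_smul_smul {C : Type*} [Ring C] [Algebra ℂ C]
    (a b : ℂ) (ξ η : C ⊗[ℂ] C) :
    hashMul (a • ξ) (b • η) = (a * b) • hashMul ξ η := by
  simp only [hashMul, map_smul, smul_mul_smul_comm]

/-- `(1 ⊗ A) m*(1)` is `#`-idempotent up to the factor `δ²`. -/
lemma hashMul_lTensor_mstar_one {ψ : B →ₗ[ℂ] ℂ} (hψ : IsState ψ)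
    {mstar : B →ₗ[ℂ] B ⊗[ℂ] B} (hadj : IsAdjointMul ψ mstar) {δ : ℝ}
    {A : B →ₗ[ℂ] B} (hA : IsQAdj mstar δ A) :
    hashMul (A.lTensor B (mstar 1)) (A.lTensor B (mstar 1)) =
      ((δ : ℂ) ^ 2) • A.lTensor B (mstar 1) := by
  obtain ⟨s, hs⟩ := TensorProduct.exists_finset (mstar 1)
  have hl (x : B) : mstar x = ∑ i ∈ s, (x * i.1) ⊗ₜ[ℂ] i.2 := by
    have h := hadj.left_mul hψ x 1
    rw [mul_one, hs, Finset.mul_sum] at h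
    simpa using h
  have hr (x : B) : mstar x = ∑ i ∈ s, i.1 ⊗ₜ[ℂ] (i.2 * x) := by
    have h := hadj.right_mul hψ 1 x
    rw [one_mul, hs, Finset.sum_mul] at h
    simpa using h
  have hswap (i : B × B) :
      ∑ j ∈ s, (i.1 * j.1) ⊗ₜ[ℂ] (A j.2 * A i.2) =
        ∑ j ∈ s, j.1 ⊗ₜ[ℂ] (A (j.2 * i.1) * A i.2) := by
    have h := congrArg ((LinearMap.mulRight ℂ (A i.2) ∘ₗ A).lTensor B)
      ((hl i.1).symm.trans (hr i.1))
    simpa using h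
  have hQ (j : B × B) : ∑ i ∈ s, A (j.2 * i.1) * A i.2 = ((δ : ℂ) ^ 2) • A j.2 := by
    rw [← hA, hl]
    simp
  simp only [hs, map_sum, LinearMap.lTensor_tmul, hashMul_sum_sum, hashMul_tmul, hswap]
  rw [Finset.sum_comm, Finset.smul_sum]
  refine Finset.sum_congr rfl fun j _ => ?_
  rw [← TensorProduct.tmul_sum, hQ, TensorProduct.tmul_smul]

/-- The quantum edge indicator is a `#`-idempotent: `ε_G # ε_G = ε_G`. -/
theorem stmt_6 {B : Type*} [Ring B] [StarRing B] [Algebra ℂ B] [StarModule ℂ B]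
    [Module.Finite ℂ B] [Module.Free ℂ B]
    (ψ : B →ₗ[ℂ] ℂ) (hψ : IsState ψ)
    (mstar : B →ₗ[ℂ] B ⊗[ℂ] B) (hadj : IsAdjointMul ψ mstar)
    (δ : ℝ) (hδ : 0 < δ) (hdelta : IsDeltaForm mstar δ)
    (A : B →ₗ[ℂ] B) (hA : IsQAdj mstar δ A) :
    hashMul (edgeInd mstar δ A) (edgeInd mstar δ A) = edgeInd mstar δ A := by
  have hδ2 : (δ : ℂ) ^ 2 ≠ 0 := pow_ne_zero 2 (Complex.ofReal_ne_zero.2 hδ.ne')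
  rw [edgeInd, hashMul_smul_smul, hashMul_lTensor_mstar_one hψ hadj hA, smul_smul, mul_assoc,
    inv_mul_cancel₀ hδ2, mul_one]

end
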